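/- arXiv:2510.15640 — 2 statements merged into one kernel-verified Lean document; each statement's English description precedes it below -/
import Mathlib

section
/- Let (L, {,,}) be a 3-Lie algebra over a field k of characteristic 0 and (V;ρ) a representation of it. Then a skew-symmetric trilinear map ψ: L×L×L→V is a 2-cocycle of L with coefficients in V if and only if the bracket {(a,u),(b,v),(c,w)}_{⋉ψ} := ({a,b,c}, ρ(a,b)w + ρ(b,c)u + ρ(c,a)v + ψ(a,b,c)) makes L⊕V into a 3-Lie algebra. -/
namespace NPPaper

variable {A V : Type*} [AddCommGroup A] [AddCommGroup V]

/-- A commutative associative multiplication (axioms on a plain binary operation). -/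
def IsCommAssocFun (m : A → A → A) : Prop :=
  (∀ a b, m a b = m b a) ∧ (∀ a b c, m (m a b) c = m a (m b c))

/-- A 3-Lie bracket: skew-symmetric and satisfying the fundamental identity. -/
def IsThreeLieFun (br : A → A → A → A) : Prop :=
  (∀ a b c, br a b c = - br b a c) ∧ (∀ a b c, br a b c = - br a c b) ∧
  (∀ a b c d e, br a b (br c d e) =
      br (br a b c) d e + br c (br a b d) e + br c d (br a b e))

/-- A Nambu-Poisson structure: commutative associative product, 3-Lie bracket,
and the Leibniz rule. -/
def IsNambuPoissonFun (m : A → A → A) (br : A → A → A → A) : Prop :=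
  IsCommAssocFun m ∧ IsThreeLieFun br ∧
  (∀ a b c d, br a b (m c d) = m (br a b c) d + m c (br a b d))

/-- A representation of a 3-Lie algebra (pointwise form, skew-symmetry included). -/
def IsThreeLieRepFun (br : A → A → A → A) (ρ : A → A → V → V) : Prop :=
  (∀ a b v, ρ a b v = - ρ b a v) ∧
  (∀ a b c d v, ρ a b (ρ c d v) - ρ c d (ρ a b v) =
      ρ (br a b c) d v + ρ c (br a b d) v) ∧
  (∀ a b c d v, ρ (br a b c) d v =
      ρ a b (ρ c d v) + ρ b c (ρ a d v) + ρ c a (ρ b d v))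

/-- A representation of a Nambu-Poisson algebra (pointwise form). -/
def IsNPRepFun (m : A → A → A) (br : A → A → A → A)
    (μ : A → V → V) (ρ : A → A → V → V) : Prop :=
  (∀ a b v, μ (m a b) v = μ a (μ b v)) ∧
  IsThreeLieRepFun br ρ ∧
  (∀ a b c v, μ (br a b c) v = ρ a b (μ c v) - μ c (ρ a b v)) ∧
  (∀ a b c v, ρ a (m b c) v = μ b (ρ a c v) + μ c (ρ a b v))

/-- A Harrison 2-cocycle of a commutative associative algebra with coefficients
in a representation. -/
def IsHarrison2CocycleFun (m : A → A → A) (μ : A → V → V) (φ : A → A → V) : Prop :=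
  (∀ a b, φ a b = φ b a) ∧
  (∀ a b c, μ a (φ b c) - φ (m a b) c + φ a (m b c) - μ c (φ a b) = 0)

/-- A 2-cocycle of a 3-Lie algebra with coefficients in a representation. -/
def IsThreeLie2CocycleFun (br : A → A → A → A) (ρ : A → A → V → V)
    (ψ : A → A → A → V) : Prop :=
  (∀ a b c, ψ a b c = - ψ b a c) ∧ (∀ a b c, ψ a b c = - ψ a c b) ∧
  (∀ a b c d e, ψ a b (br c d e) + ρ a b (ψ c d e) =
      ψ (br a b c) d e + ψ c (br a b d) e + ψ c d (br a b e)
      + ρ d e (ψ a b c) + ρ e c (ψ a b d) + ρ c d (ψ a b e))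

/-- A Nambu-Poisson 2-cocycle. -/
def IsNP2CocycleFun (m : A → A → A) (br : A → A → A → A)
    (μ : A → V → V) (ρ : A → A → V → V)
    (φ : A → A → V) (ψ : A → A → A → V) : Prop :=
  IsHarrison2CocycleFun m μ φ ∧ IsThreeLie2CocycleFun br ρ ψ ∧
  (∀ a b c d, ψ a b (m c d) + ρ a b (φ c d) =
      φ c (br a b d) + μ c (ψ a b d) + φ (br a b c) d + μ d (ψ a b c))

/-- A Poisson algebra structure. -/
def IsPoissonFun (m : A → A → A) (pb : A → A → A) : Prop :=
  IsCommAssocFun m ∧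
  (∀ a b, pb a b = - pb b a) ∧
  (∀ a b c, pb a (pb b c) = pb (pb a b) c + pb b (pb a c)) ∧
  (∀ a b c, pb a (m b c) = m (pb a b) c + m b (pb a c))

/-- A representation of a Poisson algebra (pointwise form). -/
def IsPoissonRepFun (m : A → A → A) (pb : A → A → A) (μ ρb : A → V → V) : Prop :=
  (∀ a b v, μ (m a b) v = μ a (μ b v)) ∧
  (∀ a b v, ρb (pb a b) v = ρb a (ρb b v) - ρb b (ρb a v)) ∧
  (∀ a b v, μ (pb a b) v = ρb a (μ b v) - μ b (ρb a v)) ∧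
  (∀ a b v, ρb (m a b) v = μ a (ρb b v) + μ b (ρb a v))

/-- A Poisson 2-cocycle. -/
def IsPoisson2CocycleFun (m pb : A → A → A) (μ ρb : A → V → V)
    (φ ψb : A → A → V) : Prop :=
  IsHarrison2CocycleFun m μ φ ∧
  (∀ a b, ψb a b = - ψb b a) ∧
  (∀ a b c, ρb a (ψb b c) + ρb b (ψb c a) + ρb c (ψb a b)
      + ψb a (pb b c) + ψb b (pb c a) + ψb c (pb a b) = 0) ∧
  (∀ a b c, ψb a (m b c) + ρb a (φ b c) =
      φ b (pb a c) + μ b (ψb a c) + φ (pb a b) c + μ c (ψb a b))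

/-- A Nijenhuis operator on a Nambu-Poisson algebra. -/
def IsNijenhuisFun (m : A → A → A) (br : A → A → A → A) (N : A → A) : Prop :=
  (∀ a b, m (N a) (N b) = N (m (N a) b + m a (N b) - N (m a b))) ∧
  (∀ a b c, br (N a) (N b) (N c) =
      N (br (N a) (N b) c + br (N a) b (N c) + br a (N b) (N c)
        - N (br (N a) b c + br a (N b) c + br a b (N c) - N (br a b c))))

/-- The total multiplication `a ⊙ b = a ⋄ b + b ⋄ a + a * b` of an NS-commutative algebra. -/
def odotFun (d s : A → A → A) (a b : A) : A := d a b + d b a + s a b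

/-- The total bracket `{{a,b,c}} = [a,b,c] + [b,c,a] + [c,a,b] + ⟦a,b,c⟧` of an NS-3-Lie algebra. -/
def ttotFun (t l : A → A → A → A) (a b c : A) : A :=
  t a b c + t b c a + t c a b + l a b c

/-- An NS-commutative algebra. -/
def IsNSCommFun (d s : A → A → A) : Prop :=
  (∀ a b, s a b = s b a) ∧
  (∀ a b c, d a (d b c) = d (odotFun d s a b) c) ∧
  (∀ a b c, d a (s b c) + s a (odotFun d s b c) = d b (s a c) + s b (odotFun d s a c))

/-- An NS-3-Lie algebra. -/
def IsNSThreeLieFun (t l : A → A → A → A) : Prop :=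
  (∀ a b c, t a b c = - t b a c) ∧
  (∀ a b c, l a b c = - l b a c) ∧ (∀ a b c, l a b c = - l a c b) ∧
  (∀ a b c d e, t a b (t c d e) =
      t (ttotFun t l a b c) d e + t c (ttotFun t l a b d) e + t c d (t a b e)) ∧
  (∀ a b c d e, t (ttotFun t l a b c) d e =
      t a b (t c d e) + t b c (t a d e) + t c a (t b d e)) ∧
  (∀ a b c d e, l a b (ttotFun t l c d e) + t a b (l c d e) =
      l (ttotFun t l a b c) d e + l c (ttotFun t l a b d) e + l c d (ttotFun t l a b e)
      + t d e (l a b c) + t e c (l a b d) + t c d (l a b e))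

/-- An NS-Nambu-Poisson algebra. -/
def IsNSNambuPoissonFun (d s : A → A → A) (t l : A → A → A → A) : Prop :=
  IsNSCommFun d s ∧ IsNSThreeLieFun t l ∧
  (∀ a b c x, d (ttotFun t l a b c) x = t a b (d c x) - d c (t a b x)) ∧
  (∀ a b c x, t (odotFun d s a b) c x = d a (t b c x) + d b (t a c x)) ∧
  (∀ a b c x, l a b (odotFun d s c x) + t a b (s c x) =
      s c (ttotFun t l a b x) + d c (l a b x) + s (ttotFun t l a b c) x + d x (l a b c))

/-- A `(φ,ψ)`-twisted O-operator. -/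
def IsTwistedOFun (m : A → A → A) (br : A → A → A → A)
    (μ : A → V → V) (ρ : A → A → V → V)
    (φ : A → A → V) (ψ : A → A → A → V) (r : V → A) : Prop :=
  (∀ u v, m (r u) (r v) = r (μ (r u) v + μ (r v) u + φ (r u) (r v))) ∧
  (∀ u v w, br (r u) (r v) (r w) =
      r (ρ (r u) (r v) w + ρ (r v) (r w) u + ρ (r w) (r u) v + ψ (r u) (r v) (r w)))

theorem statement4 {k : Type*} [Field k] [CharZero k]
    {L : Type*} [AddCommGroup L] [Module k L]
    {V : Type*} [AddCommGroup V] [Module k V]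
    (br : L →ₗ[k] L →ₗ[k] L →ₗ[k] L)
    (ρ : L →ₗ[k] L →ₗ[k] V →ₗ[k] V)
    (ψ : L →ₗ[k] L →ₗ[k] L →ₗ[k] V)
    (hbr : IsThreeLieFun (fun a b c => br a b c))
    (hrep : IsThreeLieRepFun (fun a b c => br a b c) (fun a b v => ρ a b v))
    (hψ₁ : ∀ a b c, ψ a b c = - ψ b a c)
    (hψ₂ : ∀ a b c, ψ a b c = - ψ a c b) :
    IsThreeLie2CocycleFun (fun a b c => br a b c) (fun a b v => ρ a b v)
        (fun a b c => ψ a b c) ↔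
      IsThreeLieFun (fun p q r : L × V =>
        (br p.1 q.1 r.1,
          ρ p.1 q.1 r.2 + ρ q.1 r.1 p.2 + ρ r.1 p.1 q.2 + ψ p.1 q.1 r.1)) := by
  obtain ⟨hb₁, hb₂, hbf⟩ := hbr
  obtain ⟨hρ, hρ₁, hρ₂⟩ := hrep
  beta_reduce at hb₁ hb₂ hbf hρ hρ₁ hρ₂
  constructor
  · rintro ⟨-, -, hc⟩
    beta_reduce at hc
    refine ⟨?_, ?_, ?_⟩
    · rintro ⟨a, u⟩ ⟨b, v⟩ ⟨c, w⟩
      refine Prod.ext (hb₁ a b c) ?_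
      simp only [Prod.snd_neg]
      linear_combination (norm := abel) hρ a b w + hρ b c u + hρ c a v + hψ₁ a b c
    · rintro ⟨a, u⟩ ⟨b, v⟩ ⟨c, w⟩
      refine Prod.ext (hb₂ a b c) ?_
      simp only [Prod.snd_neg]
      linear_combination (norm := abel) hρ a b w + hρ b c u + hρ c a v + hψ₂ a b c
    · rintro ⟨a, u⟩ ⟨b, v⟩ ⟨c, w⟩ ⟨d, x⟩ ⟨e, y⟩
      refine Prod.ext (hbf a b c d e) ?_
      have hcb := congrArg (ρ d e) (hρ b c u)
      have hdb := congrArg (ρ e c) (hρ b d u)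
      have heb := congrArg (ρ c d) (hρ b e u)
      simp only [Prod.snd_add, map_add, map_neg] at hcb hdb heb ⊢
      linear_combination (norm := abel) hρ₁ a b c d y + hρ₁ a b d e w + hρ₁ a b e c x
        + hρ b (br c d e) u - hρ₂ c d e b u - hcb - hdb - heb
        + hρ₂ c d e a v + hc a b c d e
  · rintro ⟨-, -, hf⟩
    refine ⟨hψ₁, hψ₂, fun a b c d e => ?_⟩
    have h := congrArg Prod.snd (hf (a, 0) (b, 0) (c, 0) (d, 0) (e, 0))
    simp only [Prod.snd_add, map_zero, zero_add, add_zero] at h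
    linear_combination (norm := abel) h

end NPPaper
end

section
/- Let (A, ·, {,,}) be a Nambu-Poisson algebra over a field k of characteristic 0 and N: A→A a Nijenhuis operator on it. Define μ_N(a)b := N(a)·b and ρ_N(a,b)c := {N(a),N(b),c}. Then (A; μ_N, ρ_N) is a representation of the deformed Nambu-Poisson algebra A_N = (A, ·_N, {,,}_N), where a·_N b := N(a)·b + a·N(b) − N(a·b) and {a,b,c}_N := {N(a),N(b),c} + {N(a),b,N(c)} + {a,N(b),N(c)} − N({N(a),b,c} + {a,N(b),c} + {a,b,N(c)} − N({a,b,c})). Moreover, the pair (φ_N, ψ_N), with φ_N(a,b) := −N(a·b) and ψ_N(a,b,c) := −N({N(a),b,c} + {a,N(b),c} + {a,b,N(c)} − N({a,b,c})), is a Nambu-Poisson 2-cocycle of A_N with coefficients in (A; μ_N, ρ_N). -/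
namespace NPPaper

variable {A V : Type*} [AddCommGroup A] [AddCommGroup V]

/-- The left-hand side of the 3-Lie cocycle condition for a Nijenhuis operator, expanded by the number
of arguments to which the operator is applied. -/
theorem nijenhuis_ternary_expansion {k A : Type*} [CommRing k] [AddCommGroup A] [Module k A]
    (br : A →ₗ[k] A →ₗ[k] A →ₗ[k] A) (N : A →ₗ[k] A)
    (hN : ∀ a b c, br (N a) (N b) (N c) =
      N (br (N a) (N b) c + br (N a) b (N c) + br a (N b) (N c)
        - N (br (N a) b c + br a (N b) c + br a b (N c) - N (br a b c))))
    (a b c d e : A) (x y : A)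
    (hx : x = br (N c) d e + br c (N d) e + br c d (N e) - N (br c d e))
    (hy : y = br (N c) (N d) e + br (N c) d (N e) + br c (N d) (N e) - N x) :
    N (br (N a) b y + br a (N b) y + br a b (N y) - N (br a b y)) + br (N a) (N b) (N x) =
      N (br a b (br (N c) (N d) (N e))
          + br (N a) b (br (N c) (N d) e + br (N c) d (N e) + br c (N d) (N e))
          + br a (N b) (br (N c) (N d) e + br (N c) d (N e) + br c (N d) (N e))
          + br (N a) (N b) (br (N c) d e + br c (N d) e + br c d (N e))
        - N (br a b (br (N c) (N d) e + br (N c) d (N e) + br c (N d) (N e))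
            + br (N a) b (br (N c) d e + br c (N d) e + br c d (N e))
            + br a (N b) (br (N c) d e + br c (N d) e + br c d (N e))
            + br (N a) (N b) (br c d e)
          - N (br a b (br (N c) d e + br c (N d) e + br c d (N e))
              + br (N a) b (br c d e) + br a (N b) (br c d e)
            - N (br a b (br c d e))))) := by
  have h₁ : N y = br (N c) (N d) (N e) := by rw [hN, hy, hx]
  have h₂ := congrArg N (hN a b (br c d e))
  rw [h₁, hN a b x, hy, hx]
  simp only [map_add, map_sub] at h₂ ⊢
  linear_combination (norm := module) -h₂

/-- The left-hand side of the compatibility condition for a Nijenhuis operator, expanded by the number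
of arguments to which the operator is applied. -/
theorem nijenhuis_bracket_mul_expansion {k A : Type*} [CommRing k] [AddCommGroup A] [Module k A]
    (m : A →ₗ[k] A →ₗ[k] A) (br : A →ₗ[k] A →ₗ[k] A →ₗ[k] A) (N : A →ₗ[k] A)
    (hm : ∀ a b, m (N a) (N b) = N (m (N a) b + m a (N b) - N (m a b)))
    (hN : ∀ a b c, br (N a) (N b) (N c) =
      N (br (N a) (N b) c + br (N a) b (N c) + br a (N b) (N c)
        - N (br (N a) b c + br a (N b) c + br a b (N c) - N (br a b c))))
    (a b c d y : A) (hy : y = m (N c) d + m c (N d) - N (m c d)) :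
    N (br (N a) b y + br a (N b) y + br a b (N y) - N (br a b y)) + br (N a) (N b) (N (m c d)) =
      N (br a b (m (N c) (N d)) + br (N a) b (m (N c) d + m c (N d))
          + br a (N b) (m (N c) d + m c (N d)) + br (N a) (N b) (m c d)
        - N (br a b (m (N c) d + m c (N d)) + br (N a) b (m c d) + br a (N b) (m c d)
          - N (br a b (m c d)))) := by
  have h₁ : N y = m (N c) (N d) := by rw [hm, hy]
  rw [h₁, hN a b (m c d), hy]
  simp only [map_add, map_sub]
  module

/-- One summand of the right-hand side of the compatibility condition for a Nijenhuis operator,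
expanded by the number of arguments to which the operator is applied. -/
theorem nijenhuis_mul_bracket_expansion {k A : Type*} [CommRing k] [AddCommGroup A] [Module k A]
    (m : A →ₗ[k] A →ₗ[k] A) (br : A →ₗ[k] A →ₗ[k] A →ₗ[k] A) (N : A →ₗ[k] A)
    (hm : ∀ a b, m (N a) (N b) = N (m (N a) b + m a (N b) - N (m a b)))
    (a b c d x y : A)
    (hx : x = br (N a) b d + br a (N b) d + br a b (N d) - N (br a b d))
    (hy : y = br (N a) (N b) d + br (N a) b (N d) + br a (N b) (N d) - N x) :
    N (m c y) + m (N c) (N x) =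
      N (m c (br (N a) (N b) d + br (N a) b (N d) + br a (N b) (N d))
          + m (N c) (br (N a) b d + br a (N b) d + br a b (N d))
        - N (m c (br (N a) b d + br a (N b) d + br a b (N d)) + m (N c) (br a b d)
          - N (m c (br a b d)))) := by
  have h := congrArg N (hm c (br a b d))
  rw [hm c x, hy, hx]
  simp only [map_add, map_sub] at h ⊢
  linear_combination (norm := module) -h

theorem statement16 {k : Type*} [Field k] [CharZero k]
    {A : Type*} [AddCommGroup A] [Module k A]
    (m : A →ₗ[k] A →ₗ[k] A) (br : A →ₗ[k] A →ₗ[k] A →ₗ[k] A)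
    (hA : IsNambuPoissonFun (fun a b => m a b) (fun a b c => br a b c))
    (N : A →ₗ[k] A)
    (hN : IsNijenhuisFun (fun a b => m a b) (fun a b c => br a b c) (fun a => N a)) :
    IsNPRepFun
        (fun a b => m (N a) b + m a (N b) - N (m a b))
        (fun a b c => br (N a) (N b) c + br (N a) b (N c) + br a (N b) (N c)
          - N (br (N a) b c + br a (N b) c + br a b (N c) - N (br a b c)))
        (fun a v => m (N a) v) (fun a b v => br (N a) (N b) v)
      ∧ IsNP2CocycleFun
          (fun a b => m (N a) b + m a (N b) - N (m a b))
          (fun a b c => br (N a) (N b) c + br (N a) b (N c) + br a (N b) (N c)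
            - N (br (N a) b c + br a (N b) c + br a b (N c) - N (br a b c)))
          (fun a v => m (N a) v) (fun a b v => br (N a) (N b) v)
          (fun a b => - N (m a b))
          (fun a b c => - N (br (N a) b c + br a (N b) c + br a b (N c) - N (br a b c))) := by
  obtain ⟨⟨mc, ma⟩, ⟨s₁, s₂, fi⟩, lb⟩ := hA
  obtain ⟨nm, nb⟩ := hN
  simp only at mc ma s₁ s₂ fi lb nm nb
  have cyc (a b c : A) : br a b c = br b c a := by rw [s₁ a b c, s₂ b a c, neg_neg]
  have fi' (a b c d e : A) : br a b (br c d e) =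
      br d e (br a b c) + br e c (br a b d) + br c d (br a b e) := by
    rw [fi, cyc (br a b c), ← cyc e c]
  have lb' (a b c d : A) : br a b (m c d) = m d (br a b c) + m c (br a b d) := by
    rw [lb, mc d]
  refine ⟨⟨?_, ⟨?_, ?_, ?_⟩, ?_, ?_⟩, ⟨?_, ?_⟩, ⟨?_, ?_, ?_⟩, ?_⟩
  · intro a b v
    simp only [← nm, ma]
  · intro a b v
    exact s₁ _ _ _
  · intro a b c d v
    simp only [← nb]
    rw [fi (N a) (N b) (N c) (N d) v]
    abel
  · intro a b c d v
    simp only [← nb]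
    rw [cyc, fi (N d) v, ← cyc (N a) (N d) v, ← cyc (N b) (N d) v, ← cyc (N c) (N d) v,
      cyc (br (N a) (N d) v), ← cyc (N c) (N a)]
    abel
  · intro a b c v
    simp only [← nb]
    rw [lb]
    abel
  · intro a b c v
    simp only [← nm]
    rw [s₂, lb', s₂ (N a) v (N b), s₂ (N a) v (N c), map_neg, map_neg]
    abel
  · intro a b
    simp only [mc a b]
  · intro a b c
    have h₁ := nm a (m b c)
    have h₂ := nm c (m a b)
    simp only [map_add, map_sub, map_neg, LinearMap.add_apply, LinearMap.sub_apply, ma] at h₁ h₂ ⊢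
    rw [mc (N c) (m a b), mc c (N (m a b)), mc c (m a b)] at h₂
    simp only [ma] at h₂
    linear_combination (norm := module) h₂ - h₁
  · intro a b c
    simp only [s₁ b a, s₁ (N b) a, s₁ b (N a), map_add, map_sub, map_neg]
    module
  · intro a b c
    simp only [s₂ a c b, s₂ (N a) c b, s₂ a (N c) b, s₂ a c (N b), map_add, map_sub, map_neg]
    module
  · intro a b c d e
    obtain ⟨D, hD⟩ : ∃ D : A → A → A → A, ∀ a b c, D a b c =
        br (N a) (N b) c + br (N a) b (N c) + br a (N b) (N c)
          - N (br (N a) b c + br a (N b) c + br a b (N c) - N (br a b c)) :=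
      ⟨_, fun _ _ _ => rfl⟩
    have E (a b c d e : A) := nijenhuis_ternary_expansion br N nb a b c d e _ (D c d e) rfl (hD c d e)
    have h := (E a b c d e).trans (Eq.trans ?_ (congrArg₂ HAdd.hAdd
      (congrArg₂ HAdd.hAdd (E d e a b c) (E e c a b d)) (E c d a b e)).symm)
    · have P (a b c : A) : br (N a) b c + br a (N b) c + br a b (N c) - N (br a b c) =
          br (N b) c a + br b (N c) a + br b c (N a) - N (br b c a) := by
        rw [cyc (N a), cyc a (N b), cyc a b (N c), cyc a b c]
        abel
      simp only [← hD]
      rw [P (D a b c) d e, ← P e c (D a b d), map_neg, map_neg, map_neg, map_neg]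
      linear_combination (norm := module) -h
    · have split {p p₁ p₂ p₃ q q₁ q₂ q₃ r r₁ r₂ r₃ s s₁ s₂ s₃ : A} (hp : p = p₁ + p₂ + p₃)
          (hq : q = q₁ + q₂ + q₃) (hr : r = r₁ + r₂ + r₃) (hs : s = s₁ + s₂ + s₃) :
          N (p - N (q - N (r - N s))) = N (p₁ - N (q₁ - N (r₁ - N s₁)))
            + N (p₂ - N (q₂ - N (r₂ - N s₂))) + N (p₃ - N (q₃ - N (r₃ - N s₃))) := by
        subst hp hq hr hs
        simp only [map_add, map_sub]
        abel
      refine split ?_ ?_ ?_ (fi' a b c d e) <;>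
      · simp only [map_add, fi' a b, fi' (N a) b, fi' a (N b), fi' (N a) (N b)]
        abel
  · intro a b c d
    have h₁ := nijenhuis_bracket_mul_expansion m br N nm nb a b c d _ rfl
    have h₂ := nijenhuis_mul_bracket_expansion m br N nm a b c d _ _ rfl rfl
    have h₃ := nijenhuis_mul_bracket_expansion m br N nm a b d c _ _ rfl rfl
    have h := h₁.trans (Eq.trans ?_ (congrArg₂ HAdd.hAdd h₂ h₃).symm)
    · simp only [map_neg]
      rw [mc (_ - _) d]
      linear_combination (norm := module) -h
    · simp only [map_add, lb']
      simp only [map_add, map_sub]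
      module

end NPPaper
end
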